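/- Let θ₁(n) be defined by (2n−1)!!/(2n)!! = 1/√(π(n + θ₁(n))) for positive integers n, i.e., θ₁(n) = [Γ(n+1)/Γ(n+1/2)]² − n. Then θ₁(n) → 1/4 as n → ∞ and θ₁(1) = 4/π − 1; consequently the constants 4/π − 1 and 1/4 in the double inequality 1/√(π(n + 4/π − 1)) ≤ (2n−1)!!/(2n)!! < 1/√(π(n + 1/4)) are best possible. -/

import Mathlib

open Nat Real Filter

/-- `θ₁(x) = [Γ(x+1)/Γ(x+1/2)]² − x`. -/
noncomputable def theta1 (x : ℝ) : ℝ :=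
  (Real.Gamma (x + 1) / Real.Gamma (x + 1 / 2)) ^ 2 - x

theorem Gamma_midpoint_sq_le {x y : ℝ} (hx : 0 < x) (hy : 0 < y) :
    Real.Gamma ((x + y) / 2) ^ 2 ≤ Real.Gamma x * Real.Gamma y := by
  have h := Real.Gamma_mul_add_mul_le_rpow_Gamma_mul_rpow_Gamma hx hy
    (a := 1 / 2) (b := 1 / 2) (by norm_num) (by norm_num) (by norm_num)
  rw [← Real.sqrt_eq_rpow, ← Real.sqrt_eq_rpow,
    show 1 / 2 * x + 1 / 2 * y = (x + y) / 2 by ring] at h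
  calc Real.Gamma ((x + y) / 2) ^ 2
      ≤ (√(Real.Gamma x) * √(Real.Gamma y)) ^ 2 :=
        pow_le_pow_left₀ (Real.Gamma_pos_of_pos (by positivity)).le h 2
    _ = Real.Gamma x * Real.Gamma y := by
        rw [mul_pow, Real.sq_sqrt (Real.Gamma_pos_of_pos hx).le,
          Real.sq_sqrt (Real.Gamma_pos_of_pos hy).le]

theorem theta1_nonneg {x : ℝ} (hx : 0 < x) : 0 ≤ theta1 x := by
  have h := Gamma_midpoint_sq_le hx (y := x + 1) (by positivity)
  rw [show (x + (x + 1)) / 2 = x + 1 / 2 by ring] at h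
  have hg := Real.Gamma_pos_of_pos (show 0 < x + 1 / 2 by positivity)
  have hx1 := Real.Gamma_add_one hx.ne'
  rw [theta1, sub_nonneg, div_pow, le_div_iff₀ (by positivity)]
  calc x * Real.Gamma (x + 1 / 2) ^ 2 ≤ x * (Real.Gamma x * Real.Gamma (x + 1)) := by gcongr
    _ = Real.Gamma (x + 1) ^ 2 := by rw [hx1]; ring

theorem theta1_le_half {x : ℝ} (hx : 0 < x) : theta1 x ≤ 1 / 2 := by
  have h := Gamma_midpoint_sq_le (x := x + 1 / 2) (y := x + 1 / 2 + 1) (by positivity)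
    (by positivity)
  rw [show (x + 1 / 2 + (x + 1 / 2 + 1)) / 2 = x + 1 by ring,
    Real.Gamma_add_one (show x + 1 / 2 ≠ 0 by positivity)] at h
  have hg := Real.Gamma_pos_of_pos (show 0 < x + 1 / 2 by positivity)
  rw [theta1, sub_le_iff_le_add, div_pow, div_le_iff₀ (by positivity)]
  linarith

theorem add_theta1_pos {x : ℝ} (hx : 0 ≤ x) : 0 < x + theta1 x := by
  have h1 := Real.Gamma_pos_of_pos (show 0 < x + 1 by positivity)
  have h2 := Real.Gamma_pos_of_pos (show 0 < x + 1 / 2 by positivity)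
  rw [theta1, add_sub_cancel]
  positivity

theorem add_theta1_succ {x : ℝ} (hx : 0 ≤ x) :
    x + 1 + theta1 (x + 1) = (x + theta1 x) * ((x + 1) / (x + 1 / 2)) ^ 2 := by
  have h1 := Real.Gamma_add_one (show x + 1 ≠ 0 by positivity)
  have h2 := Real.Gamma_add_one (show x + 1 / 2 ≠ 0 by positivity)
  rw [theta1, theta1, add_sub_cancel, add_sub_cancel, h1,
    show x + 1 + 1 / 2 = x + 1 / 2 + 1 by ring, h2,
    mul_div_mul_comm, mul_pow, mul_comm]

theorem tendsto_add_theta1_div {h : ℕ → ℝ} (h0 : ∀ n : ℕ, n < h n)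
    (h1 : ∀ n : ℕ, h n ≤ n + 1 / 2) :
    Tendsto (fun n : ℕ => (n + theta1 n) / h n) atTop (nhds 1) := by
  have key : Tendsto (fun n : ℕ => (1 / 2 : ℝ) / n) atTop (nhds 0) :=
    tendsto_const_div_atTop_nhds_zero_nat _
  rw [tendsto_iff_norm_sub_tendsto_zero]
  refine squeeze_zero' (Eventually.of_forall fun _ => norm_nonneg _) ?_ key
  filter_upwards [eventually_gt_atTop 0] with n hn
  have hn' : (0 : ℝ) < n := by exact_mod_cast hn
  have hh := hn'.trans (h0 n)
  have l := theta1_nonneg hn'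
  have u := theta1_le_half hn'
  rw [div_sub_one hh.ne', norm_div, Real.norm_of_nonneg hh.le]
  refine div_le_div₀ (by norm_num) ?_ hn' (h0 n).le
  rw [Real.norm_eq_abs, abs_le]
  constructor <;> linarith [h0 n, h1 n]

theorem quarter_le_theta1 (n : ℕ) : 1 / 4 ≤ theta1 n := by
  have anti : Antitone fun n : ℕ => (n + theta1 n) / (n + 1 / 4) := by
    refine antitone_nat_of_succ_le fun n => ?_
    have hp := add_theta1_pos n.cast_nonneg
    push_cast
    rw [add_theta1_succ n.cast_nonneg, mul_div_assoc, div_eq_mul_inv _ ((n : ℝ) + 1 / 4)]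
    refine mul_le_mul_of_nonneg_left ?_ hp.le
    rw [div_pow, div_div, ← one_div, div_le_div_iff₀ (by positivity) (by positivity)]
    nlinarith
  have h := anti.le_of_tendsto
    (tendsto_add_theta1_div (fun n => by linarith) (fun n => by linarith)) n
  rw [le_div_iff₀ (by positivity)] at h
  linarith

theorem theta1_le (n : ℕ) : theta1 n ≤ 1 / 4 + 1 / 4 / (n + 1) := by
  have mono : Monotone fun n : ℕ => (n + theta1 n) / (n + (1 / 4 + 1 / 4 / (n + 1))) := by
    refine monotone_nat_of_le_succ fun n => ?_
    have hp := add_theta1_pos n.cast_nonneg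
    push_cast
    rw [add_theta1_succ n.cast_nonneg, mul_div_assoc, div_eq_mul_inv]
    refine mul_le_mul_of_nonneg_left ?_ hp.le
    have hn : (0 : ℝ) ≤ n := n.cast_nonneg
    rw [show (n : ℝ) + (1 / 4 + 1 / 4 / (n + 1)) = (n ^ 2 + 5 / 4 * n + 1 / 2) / (n + 1) by
        field_simp; ring,
      show (n : ℝ) + 1 + (1 / 4 + 1 / 4 / (n + 1 + 1)) =
        (n ^ 2 + 13 / 4 * n + 11 / 4) / (n + 2) by field_simp; ring,
      inv_div, div_pow, div_div_div_eq, div_le_div_iff₀ (by positivity) (by positivity)]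
    have : ((n : ℝ) ^ 2 + 13 / 4 * n + 11 / 4) * (n + 1 / 2) ^ 2 ≤
        (n ^ 2 + 5 / 4 * n + 1 / 2) * (n + 1) * (n + 2) := by nlinarith
    nlinarith [mul_le_mul_of_nonneg_left this (show (0 : ℝ) ≤ n + 1 by positivity)]
  have b (n : ℕ) : 1 / 4 / ((n : ℝ) + 1) ≤ 1 / 4 :=
    div_le_self (by norm_num) (by linarith [(n.cast_nonneg : (0 : ℝ) ≤ n)])
  have h := mono.ge_of_tendsto
    (tendsto_add_theta1_div (fun n => lt_add_of_pos_right _ (by positivity))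
      (fun n => by linarith [b n])) n
  rw [div_le_one (by positivity)] at h
  linarith

theorem tendsto_theta1_nat : Tendsto (fun n : ℕ => theta1 n) atTop (nhds (1 / 4)) := by
  refine tendsto_of_tendsto_of_tendsto_of_le_of_le tendsto_const_nhds ?_
    quarter_le_theta1 theta1_le
  have h : Tendsto (fun n : ℕ => (1 / 4 : ℝ) / (n + 1)) atTop (nhds 0) := by
    exact_mod_cast (tendsto_add_atTop_iff_nat 1).2
      (tendsto_const_div_atTop_nhds_zero_nat (1 / 4 : ℝ))
  simpa only [add_zero] using h.const_add (1 / 4)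

theorem theta1_one : theta1 1 = 4 / π - 1 := by
  have h := Real.Gamma_add_one (show (1 / 2 : ℝ) ≠ 0 by norm_num)
  rw [theta1, Real.Gamma_add_one one_ne_zero, Real.Gamma_one, add_comm (1 : ℝ) (1 / 2), h,
    Real.Gamma_one_half_eq, mul_one, div_pow, mul_pow (1 / 2) √π, Real.sq_sqrt Real.pi_pos.le]
  field_simp
  norm_num

theorem doubleFactorial_ratio_eq (n : ℕ) :
    (Nat.doubleFactorial (2 * n - 1) : ℝ) / (Nat.doubleFactorial (2 * n)) =
      1 / Real.sqrt (π * (n + theta1 n)) := by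
  have h1 := Real.Gamma_pos_of_pos (show 0 < (n : ℝ) + 1 by positivity)
  have h2 := Real.Gamma_pos_of_pos (show 0 < (n : ℝ) + 1 / 2 by positivity)
  rw [theta1, add_sub_cancel, Real.sqrt_mul Real.pi_pos.le, Real.sqrt_sq (by positivity),
    Real.Gamma_nat_add_half, Real.Gamma_nat_eq_factorial, Nat.doubleFactorial_two_mul]
  have : 0 < √π := Real.sqrt_pos.2 Real.pi_pos
  push_cast
  field_simp

/-- With `θ₁(n)` defined by `(2n−1)!!/(2n)!! = 1/√(π(n + θ₁(n)))`, i.e.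
`θ₁(n) = [Γ(n+1)/Γ(n+1/2)]² − n`, one has `θ₁(n) → 1/4` as `n → ∞` and
`θ₁(1) = 4/π − 1`; consequently the constants `4/π − 1` and `1/4` in the double
inequality `1/√(π(n + 4/π − 1)) ≤ (2n−1)!!/(2n)!! < 1/√(π(n + 1/4))` are best
possible. -/
theorem theta1_limit_and_value_and_best_possible :
    Tendsto (fun n : ℕ => theta1 n) atTop (nhds (1 / 4)) ∧
    theta1 1 = 4 / π - 1 ∧
    (∀ a : ℝ,
      (∀ n : ℕ, 0 < n →
        1 / Real.sqrt (π * (n + a)) ≤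
          (Nat.doubleFactorial (2 * n - 1) : ℝ) / (Nat.doubleFactorial (2 * n))) →
      4 / π - 1 ≤ a) ∧
    (∀ b : ℝ,
      (∀ n : ℕ, 0 < n →
        (Nat.doubleFactorial (2 * n - 1) : ℝ) / (Nat.doubleFactorial (2 * n)) <
          1 / Real.sqrt (π * (n + b))) →
      b ≤ 1 / 4) := by
  refine ⟨tendsto_theta1_nat, theta1_one, fun a h => ?_, fun b h => ?_⟩
  · have key (n : ℕ) (hn : 0 < n) (hna : 0 < n + a) : theta1 n ≤ a := by
      have hp := add_theta1_pos (x := n) n.cast_nonneg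
      have := h n hn
      rw [doubleFactorial_ratio_eq, one_div_le_one_div (by positivity) (by positivity),
        Real.sqrt_le_sqrt_iff (by positivity), mul_le_mul_iff_right₀ Real.pi_pos] at this
      linarith
    obtain ⟨N, hN⟩ := exists_nat_gt (-a)
    have ha := key (N + 1) N.succ_pos (by push_cast; linarith)
    have hq := quarter_le_theta1 (N + 1)
    have := key 1 one_pos (by rw [Nat.cast_one]; linarith)
    rwa [Nat.cast_one, theta1_one] at this
  · refine ge_of_tendsto tendsto_theta1_nat ?_
    filter_upwards [eventually_gt_atTop 0] with n hn
    have hp := add_theta1_pos (x := n) n.cast_nonneg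
    have := h n hn
    rw [doubleFactorial_ratio_eq] at this
    have hs : 0 < √(π * (n + b)) := one_div_pos.1 (lt_trans (by positivity) this)
    rw [one_div_lt_one_div (by positivity) hs, Real.sqrt_lt_sqrt_iff_of_pos (by positivity),
      mul_lt_mul_iff_right₀ Real.pi_pos] at this
    linarith
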